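/- arXiv:2104.10946 — 2 statements merged into one kernel-verified Lean document; each statement's English description precedes it below -/
import Mathlib

section
/- Let A = V + XY* ∈ ℂ^{n×n} with V unitary and X, Y ∈ ℂ^{n×k}. Then A admits an LFR factorization: there exist a unitary k-lower Hessenberg matrix L ∈ ℂ^{n×n}, a unitary k-upper Hessenberg matrix R ∈ ℂ^{n×n}, a unitary matrix Û ∈ ℂ^{(n−k)×(n−k)}, and Z ∈ ℂ^{n×k} such that A = L (U + E Z*) R, where U = diag(I_k, Û) and E = [I_k; 0] ∈ ℂ^{n×k}. -/
open Matrix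

/-- A matrix is `k`-upper Hessenberg if its entries vanish below the `k`-th subdiagonal. -/
def IsKUpperHessenberg {m : ℕ} (k : ℕ) (R : Matrix (Fin m) (Fin m) ℂ) : Prop :=
  ∀ i j : Fin m, (j : ℕ) + k < (i : ℕ) → R i j = 0

/-- A matrix is `k`-lower Hessenberg if its entries vanish above the `k`-th superdiagonal. -/
def IsKLowerHessenberg {m : ℕ} (k : ℕ) (L : Matrix (Fin m) (Fin m) ℂ) : Prop :=
  ∀ i j : Fin m, (i : ℕ) + k < (j : ℕ) → L i j = 0

/-- Fewer than `finrank` many vectors admit a common orthogonal unit vector. -/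
theorem exists_norm_eq_one_forall_inner_eq_zero {𝕜 E ι : Type*} [RCLike 𝕜]
    [NormedAddCommGroup E] [InnerProductSpace 𝕜 E] [FiniteDimensional 𝕜 E] [Fintype ι]
    (g : ι → E) (hg : Fintype.card ι < Module.finrank 𝕜 E) :
    ∃ u : E, ‖u‖ = 1 ∧ ∀ i, inner 𝕜 (g i) u = 0 := by
  have hne : (Submodule.span 𝕜 (Set.range g))ᗮ ≠ ⊥ := by
    intro h
    rw [Submodule.orthogonal_eq_bot_iff] at h
    have h1 : (Set.range g).finrank 𝕜 ≤ Fintype.card ι := finrank_range_le_card g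
    rw [Set.finrank, h, finrank_top] at h1
    omega
  obtain ⟨w, hw, hw0⟩ := Submodule.exists_mem_ne_zero_of_ne_bot hne
  refine ⟨((‖w‖⁻¹ : ℝ) : 𝕜) • w, ?_, fun i => ?_⟩
  · rw [norm_smul, RCLike.norm_ofReal, abs_of_nonneg (by positivity)]
    exact inv_mul_cancel₀ (norm_ne_zero_iff.mpr hw0)
  · rw [inner_smul_right, (Submodule.mem_orthogonal _ _).mp hw _
      (Submodule.subset_span ⟨i, rfl⟩), mul_zero]

/-- The orthogonal complement of `k` vectors `x` contains an orthonormal family `v` indexed by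
the last `t ≤ n - k` indices, whose member `v i` vanishes in its first `i - k` coordinates. -/
theorem exists_orthonormal_staircase {n k : ℕ} (x : Fin k → EuclideanSpace ℂ (Fin n)) (t : ℕ)
    (ht : t + k ≤ n) :
    ∃ v : Fin n → EuclideanSpace ℂ (Fin n), ∀ i : Fin n, n ≤ i + t →
      ‖v i‖ = 1 ∧ (∀ l, inner ℂ (x l) (v i) = 0) ∧
      (∀ r : Fin n, (r : ℕ) + k < i → v i r = 0) ∧
      ∀ j : Fin n, i < j → inner ℂ (v j) (v i) = 0 := by
  induction t with
  | zero => exact ⟨0, fun i hi => by omega⟩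
  | succ t ih =>
    obtain ⟨v, hv⟩ := ih (by omega)
    let p : Fin n := ⟨n - (t + 1), by omega⟩
    have hp : (p : ℕ) = n - (t + 1) := rfl
    let g : Fin k ⊕ Fin (p - k) ⊕ Fin t → EuclideanSpace ℂ (Fin n) :=
      Sum.elim x (Sum.elim (fun r => EuclideanSpace.single ⟨r, by omega⟩ 1)
        (fun s => v ⟨p + 1 + s, by omega⟩))
    obtain ⟨u, hu, hgu⟩ := exists_norm_eq_one_forall_inner_eq_zero (𝕜 := ℂ) g (by
      simp only [Fintype.card_sum, Fintype.card_fin, finrank_euclideanSpace]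
      omega)
    refine ⟨Function.update v p u, fun i hi => ?_⟩
    rcases eq_or_ne i p with rfl | hip
    · rw [Function.update_self]
      refine ⟨hu, fun l => hgu (.inl l), fun r hr => ?_, fun j hj => ?_⟩
      · simpa [g, EuclideanSpace.inner_single_left] using hgu (.inr (.inl ⟨r, by omega⟩))
      · rw [Function.update_of_ne hj.ne']
        have hj' : (p : ℕ) < j := hj
        have := hgu (.inr (.inr ⟨j - (p + 1), by omega⟩))
        have e : (⟨p + 1 + (j - (p + 1)), by omega⟩ : Fin n) = j := Fin.ext (by simp; omega)
        simpa [g, e] using this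
    · have hip' : (i : ℕ) ≠ p := fun h => hip (Fin.ext h)
      obtain ⟨h1, h2, h3, h4⟩ := hv i (by omega)
      rw [Function.update_of_ne hip]
      refine ⟨h1, h2, h3, fun j hj => ?_⟩
      have hj' : (i : ℕ) < j := hj
      rw [Function.update_of_ne (fun h => by subst h; omega)]
      exact h4 j hj

/-- A unitary `k`-lower Hessenberg matrix can compress the column space of an `n × k` matrix
into the first `k` coordinates. -/
theorem exists_unitary_isKLowerHessenberg_conjTranspose_mul_eq_zero {n k : ℕ} (hkn : k ≤ n)
    (X : Matrix (Fin n) (Fin k) ℂ) :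
    ∃ Q ∈ Matrix.unitaryGroup (Fin n) ℂ, IsKLowerHessenberg k Q ∧
      ∀ (i : Fin n) (l : Fin k), k ≤ (i : ℕ) → (Qᴴ * X) i l = 0 := by
  obtain ⟨v, hv⟩ := exists_orthonormal_staircase
    (fun l => WithLp.toLp 2 fun i => X i l) (n - k) (by omega)
  have horth : Orthonormal ℂ (Set.domRestrict {i : Fin n | k ≤ (i : ℕ)} v) := by
    refine ⟨fun i => (hv i (by have : k ≤ ((i : Fin n) : ℕ) := i.2; omega)).1, fun i j hij => ?_⟩
    have hi : k ≤ ((i : Fin n) : ℕ) := i.2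
    have hj : k ≤ ((j : Fin n) : ℕ) := j.2
    rcases lt_or_gt_of_ne (fun h => hij (Subtype.ext h) : (i : Fin n) ≠ j) with h | h
    · exact inner_eq_zero_symm.mp ((hv i (by omega)).2.2.2 j h)
    · exact (hv j (by omega)).2.2.2 i h
  obtain ⟨b, hb⟩ := horth.exists_orthonormalBasis_extension_of_card_eq (by simp)
  refine ⟨Matrix.of fun i j => b j i, ?_, fun i j hij => ?_, fun i l hi => ?_⟩
  · rw [Matrix.mem_unitaryGroup_iff', Matrix.star_eq_conjTranspose]
    ext i j
    have := orthonormal_iff_ite.mp b.orthonormal i j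
    rw [PiLp.inner_apply] at this
    simpa [Matrix.mul_apply, Matrix.one_apply, mul_comm] using this
  · have hj : k ≤ (j : ℕ) := by omega
    rw [Matrix.of_apply, hb j hj]
    exact (hv j (by omega)).2.2.1 i hij
  · have := inner_eq_zero_symm.mp ((hv i (by omega)).2.1 l)
    rw [← hb i hi, PiLp.inner_apply] at this
    simpa [Matrix.mul_apply, mul_comm] using this

open scoped ComplexOrder in
/-- A unitary block lower triangular matrix is block diagonal with unitary blocks. -/
theorem Matrix.fromBlocks_zero₁₂_mem_unitaryGroup {m p : Type*} [Fintype m] [Fintype p]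
    [DecidableEq m] [DecidableEq p] {a : Matrix m m ℂ} {c : Matrix p m ℂ} {d : Matrix p p ℂ}
    (h : fromBlocks a 0 c d ∈ unitaryGroup (m ⊕ p) ℂ) : c = 0 ∧ d ∈ unitaryGroup p ℂ := by
  have h1 := mem_unitaryGroup_iff.mp h
  have h2 := mem_unitaryGroup_iff'.mp h
  rw [star_eq_conjTranspose, fromBlocks_conjTranspose, fromBlocks_multiply, ← fromBlocks_one,
    fromBlocks_inj] at h1 h2
  have ha : a * aᴴ = 1 := by simpa using h1.1
  have hc : cᴴ * c = 0 := by simpa only [mul_eq_one_comm.mp ha, add_eq_left] using h2.1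
  refine ⟨Matrix.conjTranspose_mul_self_eq_zero.mp hc, mem_unitaryGroup_iff'.mpr ?_⟩
  simpa [star_eq_conjTranspose] using h2.2.2.2

/-- A unitary matrix whose upper right block of `k` rows vanishes keeps being unitary when its
first `k` rows are replaced by those of the identity, and its lower left block vanishes. -/
theorem unitary_of_upper_right_eq_zero {n k : ℕ} (hkn : k ≤ n) {M : Matrix (Fin n) (Fin n) ℂ}
    (hM : M ∈ Matrix.unitaryGroup (Fin n) ℂ)
    (h0 : ∀ i j : Fin n, (i : ℕ) < k → k ≤ (j : ℕ) → M i j = 0) :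
    (∀ i j : Fin n, k ≤ (i : ℕ) → (j : ℕ) < k → M i j = 0) ∧
    (Matrix.of fun i j : Fin n => if (i : ℕ) < k then (1 : Matrix (Fin n) (Fin n) ℂ) i j
      else M i j) ∈ Matrix.unitaryGroup (Fin n) ℂ := by
  obtain ⟨m, rfl⟩ := Nat.exists_eq_add_of_le hkn
  have key : ∀ N : Matrix (Fin (k + m)) (Fin (k + m)) ℂ,
      N ∈ Matrix.unitaryGroup (Fin (k + m)) ℂ ↔
      N.submatrix finSumFinEquiv finSumFinEquiv ∈ Matrix.unitaryGroup (Fin k ⊕ Fin m) ℂ := by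
    intro N
    rw [Matrix.mem_unitaryGroup_iff, Matrix.mem_unitaryGroup_iff, Matrix.star_eq_conjTranspose,
      Matrix.star_eq_conjTranspose, Matrix.conjTranspose_submatrix,
      Matrix.submatrix_mul_equiv, ← Matrix.submatrix_one_equiv finSumFinEquiv]
    exact (Matrix.reindex finSumFinEquiv.symm finSumFinEquiv.symm).injective.eq_iff.symm
  have hb : (M.submatrix finSumFinEquiv finSumFinEquiv).toBlocks₁₂ = 0 := by
    ext i j
    exact h0 _ _ (by simp) (by simp)
  have hM' := (key M).mp hM
  rw [← Matrix.fromBlocks_toBlocks (M.submatrix finSumFinEquiv finSumFinEquiv), hb] at hM'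
  obtain ⟨hc, hd⟩ := Matrix.fromBlocks_zero₁₂_mem_unitaryGroup hM'
  have hlow : ∀ (i : Fin m) (j : Fin k), M (Fin.natAdd k i) (Fin.castAdd m j) = 0 :=
    fun i j => by simpa [Matrix.toBlocks₂₁] using congrFun (congrFun hc i) j
  refine ⟨fun i j hi hj => ?_, (key _).mpr ?_⟩
  · have := hlow ⟨i - k, by omega⟩ ⟨j, hj⟩
    convert this using 1
    congr 1
    exact Fin.ext (by simp; omega)
  · have e : (Matrix.of fun i j : Fin (k + m) => if (i : ℕ) < k then
        (1 : Matrix (Fin (k + m)) (Fin (k + m)) ℂ) i j else M i j).submatrix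
          finSumFinEquiv finSumFinEquiv =
        Matrix.fromBlocks 1 0 0 (M.submatrix finSumFinEquiv finSumFinEquiv).toBlocks₂₂ := by
      ext (i | i) (j | j)
      · simp [Matrix.one_apply]
      · have : Fin.castAdd m i ≠ Fin.natAdd k j := fun h => by
          have := congrArg Fin.val h
          simp at this
          omega
        simp [Matrix.one_apply, this]
      · simp [hlow]
      · simp [Matrix.toBlocks₂₂]
    rw [e, Matrix.mem_unitaryGroup_iff, Matrix.star_eq_conjTranspose,
      Matrix.fromBlocks_conjTranspose, Matrix.fromBlocks_multiply]
    have := Matrix.mem_unitaryGroup_iff.mp hd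
    rw [Matrix.star_eq_conjTranspose] at this
    simp [this]

/-- **LFR factorization.** Every unitary-plus-rank-`k` matrix `A = V + XY*` can be written
as `A = L (U + E Z*) R` with `L` a unitary `k`-lower Hessenberg matrix, `R` a unitary
`k`-upper Hessenberg matrix, `U = diag(I_k, Û)` unitary (`Û` unitary), and `E = [I_k; 0]`. -/
theorem lfr_factorization {n k : ℕ} (hk : 1 ≤ k) (hkn : k < n)
    (A V : Matrix (Fin n) (Fin n) ℂ) (X Y : Matrix (Fin n) (Fin k) ℂ)
    (hV : V ∈ Matrix.unitaryGroup (Fin n) ℂ) (hA : A = V + X * Yᴴ) :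
    ∃ (L R U : Matrix (Fin n) (Fin n) ℂ) (Z : Matrix (Fin n) (Fin k) ℂ),
      L ∈ Matrix.unitaryGroup (Fin n) ℂ ∧ IsKLowerHessenberg k L ∧
      R ∈ Matrix.unitaryGroup (Fin n) ℂ ∧ IsKUpperHessenberg k R ∧
      U ∈ Matrix.unitaryGroup (Fin n) ℂ ∧
      (∀ i j : Fin n, (i : ℕ) < k ∨ (j : ℕ) < k → U i j = if i = j then 1 else 0) ∧
      A = L * (U + (Matrix.of fun (i : Fin n) (j : Fin k) => if (i : ℕ) = (j : ℕ) then (1 : ℂ) else 0)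
        * Zᴴ) * R := by
  obtain ⟨L, hL, hLH, hLX⟩ :=
    exists_unitary_isKLowerHessenberg_conjTranspose_mul_eq_zero hkn.le X
  let emb : Fin k → Fin n := Fin.castLE hkn.le
  obtain ⟨Q, hQ, hQH, hQW⟩ := exists_unitary_isKLowerHessenberg_conjTranspose_mul_eq_zero hkn.le
    ((Lᴴ * V)ᴴ.submatrix id emb)
  have hLs : Lᴴ ∈ Matrix.unitaryGroup (Fin n) ℂ := Unitary.star_mem hL
  have hM : Lᴴ * V * Q ∈ Matrix.unitaryGroup (Fin n) ℂ := mul_mem (mul_mem hLs hV) hQ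
  have hM0 : ∀ i j : Fin n, (i : ℕ) < k → k ≤ (j : ℕ) → (Lᴴ * V * Q) i j = 0 := by
    intro i j hi hj
    have h := hQW j ⟨i, hi⟩ hj
    have h' : (Lᴴ * V * Q)ᴴ j i = 0 := by
      rw [Matrix.conjTranspose_mul]
      exact h
    simpa using h'
  obtain ⟨hlow, hU⟩ := unitary_of_upper_right_eq_zero hkn.le hM hM0
  set U : Matrix (Fin n) (Fin n) ℂ := Matrix.of fun i j : Fin n =>
    if (i : ℕ) < k then (1 : Matrix (Fin n) (Fin n) ℂ) i j else (Lᴴ * V * Q) i j with hUdef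
  refine ⟨L, Qᴴ, U, ((Lᴴ * A * Q - U).submatrix emb id)ᴴ, hL, hLH, Unitary.star_mem hQ,
    fun i j hij => ?_, hU, fun i j hij => ?_, ?_⟩
  · rw [Matrix.conjTranspose_apply, hQH j i hij, star_zero]
  · by_cases hi : (i : ℕ) < k
    · simp [hUdef, hi, Matrix.one_apply]
    · have hj : (j : ℕ) < k := hij.resolve_left hi
      have hne : i ≠ j := fun h => hi (h ▸ hj)
      simp only [hUdef, Matrix.of_apply, if_neg hi, if_neg hne]
      exact hlow i j (not_lt.mp hi) hj
  · have hmid : U + (Matrix.of fun (i : Fin n) (j : Fin k) =>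
        if (i : ℕ) = (j : ℕ) then (1 : ℂ) else 0) * (((Lᴴ * A * Q - U).submatrix emb id)ᴴ)ᴴ =
        Lᴴ * A * Q := by
      rw [Matrix.conjTranspose_conjTranspose]
      ext i j
      rw [Matrix.add_apply, Matrix.mul_apply]
      by_cases hi : (i : ℕ) < k
      · rw [Finset.sum_eq_single ⟨i, hi⟩]
        · simp [emb]
        · intro b _ hb
          have : (i : ℕ) ≠ b := fun h => hb (Fin.ext h.symm)
          simp [this]
        · simp
      · rw [Finset.sum_eq_zero, add_zero]
        · have hX : Lᴴ * A * Q = Lᴴ * V * Q + Lᴴ * X * (Yᴴ * Q) := by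
            rw [hA]
            simp only [Matrix.mul_add, Matrix.add_mul, Matrix.mul_assoc]
          rw [hX, Matrix.add_apply, Matrix.mul_apply (M := Lᴴ * X), Finset.sum_eq_zero]
          · simp [hUdef, hi]
          · intro l _
            rw [hLX i l (not_lt.mp hi), zero_mul]
        · intro b _
          have : (i : ℕ) ≠ b := fun h => hi (h ▸ b.2)
          simp [this]
    have hL1 : L * Lᴴ = 1 := Matrix.mem_unitaryGroup_iff.mp hL
    have hQ1 : Q * Qᴴ = 1 := Matrix.mem_unitaryGroup_iff.mp hQ
    rw [hmid, Matrix.mul_assoc Lᴴ, ← Matrix.mul_assoc L, hL1, Matrix.one_mul, Matrix.mul_assoc,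
      hQ1, Matrix.mul_one]
end

section
/- Intermediate identity in the proof of the staircase theorem: let m = n + k and let L ∈ ℂ^{m×m} be unitary, partitioned as L = [[L11, L12],[L21, L22]] where the first block row has n rows, the first block column has k columns (so L12 ∈ ℂ^{n×n}). Let R ∈ ℂ^{m×m} be partitioned conformally with R21 ∈ ℂ^{n×n} being R(k+1:m, 1:n). Let U = diag(I_k, Û) with Û ∈ ℂ^{n×n} unitary, Z ∈ ℂ^{m×k}, E = [I_k; 0] ∈ ℂ^{m×k}, F = U + E Z*, and suppose Â = L F R has its last k rows equal to zero, with A = Â(1:n, 1:n). Then L12* A = Û R21. -/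
open Matrix

/-- Intermediate identity in the proof of the staircase theorem: if `L` is unitary,
`U = diag(I_k, Û)` with `Û` unitary, `F = U + E Z*`, and `Â = L F R` has its last `k` rows
zero, then `L12* A = Û R21`, where `L12 = L(1:n, k+1:m)`, `R21 = R(k+1:m, 1:n)` and
`A = Â(1:n, 1:n)` (with `m = n + k`). -/
theorem L12_star_A_eq_Uhat_R21 {n k : ℕ}
    (L R U F Ahat : Matrix (Fin (n + k)) (Fin (n + k)) ℂ)
    (Uhat : Matrix (Fin n) (Fin n) ℂ)
    (Z : Matrix (Fin (n + k)) (Fin k) ℂ)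
    (A : Matrix (Fin n) (Fin n) ℂ)
    (hL : L ∈ Matrix.unitaryGroup (Fin (n + k)) ℂ)
    (hUhat : Uhat ∈ Matrix.unitaryGroup (Fin n) ℂ)
    (hU : U = Matrix.of fun i j : Fin (n + k) =>
      if (i : ℕ) < k then (if (i : ℕ) = (j : ℕ) then (1 : ℂ) else 0)
      else if hjk : (j : ℕ) < k then 0
      else Uhat ⟨(i : ℕ) - k, by have := i.isLt; omega⟩ ⟨(j : ℕ) - k, by have := j.isLt; omega⟩)
    (hF : F = U + (Matrix.of fun (i : Fin (n + k)) (j : Fin k) =>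
      if (i : ℕ) = (j : ℕ) then (1 : ℂ) else 0) * Zᴴ)
    (hAhat : Ahat = L * F * R)
    (hlast : ∀ (i j : Fin (n + k)), n ≤ (i : ℕ) → Ahat i j = 0)
    (hA : A = Ahat.submatrix (Fin.castAdd k) (Fin.castAdd k)) :
    (L.submatrix (Fin.castAdd k)
        (fun j : Fin n => (⟨k + (j : ℕ), by have := j.isLt; omega⟩ : Fin (n + k))))ᴴ * A =
      Uhat * R.submatrix
        (fun i : Fin n => (⟨k + (i : ℕ), by have := i.isLt; omega⟩ : Fin (n + k)))
        (Fin.castAdd k) := by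
  have hLA : Lᴴ * Ahat = F * R := by
    rw [hAhat, Matrix.mul_assoc, ← Matrix.mul_assoc, ← star_eq_conjTranspose,
      mem_unitaryGroup_iff'.mp hL, Matrix.one_mul]
  ext i j
  have hentry := congrFun₂ hLA (⟨k + (i : ℕ), by omega⟩ : Fin (n + k)) (Fin.castAdd k j)
  rw [mul_apply, mul_apply, Fin.sum_univ_add,
    ← (finCongr (Nat.add_comm k n)).sum_comp, Fin.sum_univ_add] at hentry
  have hcorner (q : Fin k) : F ⟨k + (i : ℕ), by omega⟩ (finCongr (Nat.add_comm k n)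
      (Fin.castAdd n q)) = 0 := by
    have hE (x : Fin k) : k + (i : ℕ) ≠ x := by omega
    simp [hF, hU, mul_apply, hE]
  have hblock (q : Fin n) : F ⟨k + (i : ℕ), by omega⟩ (finCongr (Nat.add_comm k n)
      (Fin.natAdd k q)) = Uhat i q := by
    have hE (x : Fin k) : k + (i : ℕ) ≠ x := by omega
    simp [hF, hU, mul_apply, hE]
  simp only [hcorner, hblock, hlast (Fin.natAdd n _) _ (by simp), mul_zero, zero_mul,
    Finset.sum_const_zero, add_zero, zero_add] at hentry
  rw [hA, mul_apply, mul_apply]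
  exact hentry
end
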